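/- Suppose g ∈ C²([0,1]) with g'' Lipschitz, f ∈ C²([0,1]) is a probability density with f'' Lipschitz and 0 < inf_{[0,1]} f, K : ℝ → ℝ is an even function supported in [−1,1], twice continuously differentiable with K'' Lipschitz, and x ∈ (0,1). Define Δ_{x,h} = (1/(2n)) Σ_{k=1}^{N−1} [ (φ_{x,h}·g/f)(t_{x,k}) + (φ_{x,h}·g/f)(t_{x,k+1}) ] − ∫_{x−h}^{x+h} φ_{x,h}(t) g(t) dt, where t_{x,1} < ⋯ < t_{x,N} are the regular design points in [x−h,x+h]. Then there is a constant C > 0 such that |Δ_{x,h}| ≤ C/(n³h³) for all n ≥ 1 and h ∈ (0,1) with nh ≥ 1, N ≠ 0 and [x−h,x+h] ⊆ [0,1]; i.e. Δ_{x,h} = O(1/(n³h³)). -/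

import Mathlib

open MeasureTheory
open scoped Classical

/-- The scaled kernel φ_{x,h}(s) = (1/h) K((x−s)/h). -/
noncomputable def phiK (K : ℝ → ℝ) (x h s : ℝ) : ℝ := (1 / h) * K ((x - s) / h)

/-- Indices i of consecutive pairs of design points with both
    t n i and t n (i+1) in the window [x−h, x+h]; these enumerate the
    consecutive pairs (t_{x,k}, t_{x,k+1}), k = 1, …, N−1, of design points
    lying in the window (the design being increasing). -/
noncomputable def trapIdx (t : ℕ → ℕ → ℝ) (n : ℕ) (x h : ℝ) : Finset ℕ :=
  (Finset.Icc 1 (n - 1)).filter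
    (fun i => t n i ∈ Set.Icc (x - h) (x + h) ∧ t n (i + 1) ∈ Set.Icc (x - h) (x + h))

/-- The trapezoidal sum (1/(2n)) Σ_{k=1}^{N−1} (G(t_{x,k}) + G(t_{x,k+1})). -/
noncomputable def trapSum (t : ℕ → ℕ → ℝ) (n : ℕ) (x h : ℝ) (G : ℝ → ℝ) : ℝ :=
  (1 / (2 * (n : ℝ))) * ∑ i ∈ trapIdx t n x h, (G (t n i) + G (t n (i + 1)))

/-- `u` is bounded and Lipschitz on `S`. -/
def BddLipOn (S : Set ℝ) (u : ℝ → ℝ) : Prop :=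
  ∃ M : ℝ, 0 ≤ M ∧ (∀ s ∈ S, |u s| ≤ M) ∧ ∀ s ∈ S, ∀ r ∈ S, |u s - u r| ≤ M * |s - r|

namespace BddLipOn

variable {S : Set ℝ} {u v : ℝ → ℝ}

lemma add (hu : BddLipOn S u) (hv : BddLipOn S v) : BddLipOn S (fun s => u s + v s) := by
  obtain ⟨M, hM, hu1, hu2⟩ := hu
  obtain ⟨N, hN, hv1, hv2⟩ := hv
  refine ⟨M + N, by positivity, fun s hs => ?_, fun s hs r hr => ?_⟩
  · exact (abs_add_le _ _).trans (add_le_add (hu1 s hs) (hv1 s hs))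
  · calc |u s + v s - (u r + v r)| = |(u s - u r) + (v s - v r)| := by ring_nf
      _ ≤ |u s - u r| + |v s - v r| := abs_add_le _ _
      _ ≤ M * |s - r| + N * |s - r| := add_le_add (hu2 s hs r hr) (hv2 s hs r hr)
      _ = _ := by ring

lemma const (c : ℝ) : BddLipOn S (fun _ => c) :=
  ⟨|c|, abs_nonneg _, fun _ _ => le_rfl, fun s _ r _ => by simp; positivity⟩

/-- The increment of a product in terms of the increments of its factors. -/
lemma abs_mul_sub_mul_le {a b a' b' A B A' B' : ℝ} (hb : |b| ≤ B) (ha' : |a'| ≤ A)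
    (h1 : |a - a'| ≤ A') (h2 : |b - b'| ≤ B') :
    |a * b - a' * b'| ≤ A' * B + A * B' := by
  calc |a * b - a' * b'| = |(a - a') * b + a' * (b - b')| := by ring_nf
    _ ≤ |a - a'| * |b| + |a'| * |b - b'| := by
      rw [← abs_mul, ← abs_mul]; exact abs_add_le _ _
    _ ≤ _ := add_le_add
      (mul_le_mul h1 hb (abs_nonneg _) ((abs_nonneg _).trans h1))
      (mul_le_mul ha' h2 (abs_nonneg _) ((abs_nonneg _).trans ha'))

lemma mul (hu : BddLipOn S u) (hv : BddLipOn S v) : BddLipOn S (fun s => u s * v s) := by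
  obtain ⟨M, hM, hu1, hu2⟩ := hu
  obtain ⟨N, hN, hv1, hv2⟩ := hv
  refine ⟨2 * (M * N), by positivity, fun s hs => ?_, fun s hs r hr => ?_⟩
  · rw [abs_mul]
    have := mul_le_mul (hu1 s hs) (hv1 s hs) (abs_nonneg _) hM
    nlinarith [mul_nonneg hM hN]
  · refine (abs_mul_sub_mul_le (hv1 s hs) (hu1 r hr) (hu2 s hs r hr) (hv2 s hs r hr)).trans
      (le_of_eq (by ring))

lemma pow (hu : BddLipOn S u) (k : ℕ) : BddLipOn S (fun s => u s ^ k) := by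
  induction k with
  | zero => simpa using const 1
  | succ k ih => simpa only [pow_succ] using ih.mul hu

lemma inv {c : ℝ} (hc : 0 < c) (hu : BddLipOn S u) (hlb : ∀ s ∈ S, c ≤ u s) :
    BddLipOn S (fun s => (u s)⁻¹) := by
  obtain ⟨M, hM, _, hu2⟩ := hu
  have hpos : ∀ s ∈ S, 0 < u s := fun s hs => hc.trans_le (hlb s hs)
  refine ⟨c⁻¹ + M * (c⁻¹ * c⁻¹), by positivity, fun s hs => ?_, fun s hs r hr => ?_⟩
  · rw [abs_of_pos (inv_pos.2 (hpos s hs))]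
    have := inv_anti₀ hc (hlb s hs)
    have : 0 ≤ M * (c⁻¹ * c⁻¹) := by positivity
    linarith
  · have h1 := hpos s hs
    have h2 := hpos r hr
    have e : (u s)⁻¹ - (u r)⁻¹ = (u r - u s) * ((u s)⁻¹ * (u r)⁻¹) := by field_simp
    rw [e, abs_mul, abs_of_pos (a := (u s)⁻¹ * (u r)⁻¹) (by positivity), abs_sub_comm]
    calc |u s - u r| * ((u s)⁻¹ * (u r)⁻¹) ≤ (M * |s - r|) * (c⁻¹ * c⁻¹) := by
          gcongr
          · exact hu2 s hs r hr
          · exact hlb s hs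
          · exact hlb r hr
      _ ≤ (c⁻¹ + M * (c⁻¹ * c⁻¹)) * |s - r| := by
          have : 0 ≤ c⁻¹ * |s - r| := by positivity
          nlinarith

lemma of_lipschitzOnWith {a b : ℝ} {L : NNReal} (h : LipschitzOnWith L u (Set.Icc a b)) :
    BddLipOn (Set.Icc a b) u := by
  obtain ⟨B, hB⟩ := isCompact_Icc.exists_bound_of_continuousOn h.continuousOn
  refine ⟨|B| + L, by positivity, fun s hs => ?_, fun s hs r hr => ?_⟩
  · have := hB s hs
    rw [Real.norm_eq_abs] at this
    linarith [le_abs_self B, L.coe_nonneg]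
  · have := h.dist_le_mul s hs r hr
    rw [Real.dist_eq, Real.dist_eq] at this
    have : 0 ≤ |B| * |s - r| := by positivity
    linarith

lemma of_hasDerivWithinAt {a b : ℝ}
    (hd : ∀ s ∈ Set.Icc a b, HasDerivWithinAt u (v s) (Set.Icc a b) s)
    (hv : BddLipOn (Set.Icc a b) v) : BddLipOn (Set.Icc a b) u := by
  obtain ⟨M, hM, hv1, _⟩ := hv
  refine of_lipschitzOnWith (L := ⟨M, hM⟩) ?_
  exact (convex_Icc a b).lipschitzOnWith_of_nnnorm_hasDerivWithin_le hd
    fun s hs => NNReal.coe_le_coe.1 (hv1 s hs)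

end BddLipOn

lemma exists_derivs_of_contDiffOn_two {a b : ℝ} (hab : a < b) {u : ℝ → ℝ}
    (hu : ContDiffOn ℝ 2 u (Set.Icc a b)) {L : NNReal}
    (hL : LipschitzOnWith L (iteratedDerivWithin 2 u (Set.Icc a b)) (Set.Icc a b)) :
    ∃ u₁ u₂ : ℝ → ℝ,
      (∀ s ∈ Set.Icc a b, HasDerivWithinAt u (u₁ s) (Set.Icc a b) s) ∧
      (∀ s ∈ Set.Icc a b, HasDerivWithinAt u₁ (u₂ s) (Set.Icc a b) s) ∧
      BddLipOn (Set.Icc a b) u ∧ BddLipOn (Set.Icc a b) u₁ ∧ BddLipOn (Set.Icc a b) u₂ := by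
  have hU : UniqueDiffOn ℝ (Set.Icc a b) := uniqueDiffOn_Icc hab
  have h0 := hu.differentiableOn (by norm_num)
  have h1 : DifferentiableOn ℝ (derivWithin u (Set.Icc a b)) (Set.Icc a b) :=
    (hu.derivWithin hU (m := 1) (by norm_num)).differentiableOn (by norm_num)
  have d0 := fun s hs => (h0 s hs).hasDerivWithinAt
  have d1 : ∀ s ∈ Set.Icc a b, HasDerivWithinAt (derivWithin u (Set.Icc a b))
      (iteratedDerivWithin 2 u (Set.Icc a b) s) (Set.Icc a b) s := by
    intro s hs
    have := (h1 s hs).hasDerivWithinAt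
    rw [iteratedDerivWithin_succ, iteratedDerivWithin_one]
    exact this
  have b2 := BddLipOn.of_lipschitzOnWith hL
  have b1 := BddLipOn.of_hasDerivWithinAt d1 b2
  exact ⟨_, _, d0, d1, BddLipOn.of_hasDerivWithinAt d0 b1, b1, b2⟩

/-- A primitive on `[a,b]` of a function that is continuous on `[a,b]`. -/
lemma exists_primitive_of_continuousOn_Icc {a b : ℝ} (hab : a ≤ b) {u : ℝ → ℝ}
    (hu : ContinuousOn u (Set.Icc a b)) :
    ∃ U : ℝ → ℝ, (∀ s ∈ Set.Icc a b, HasDerivWithinAt U (u s) (Set.Icc a b) s) ∧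
      ∀ p ∈ Set.Icc a b, ∀ q ∈ Set.Icc a b, ∫ s in p..q, u s = U q - U p := by
  set v : ℝ → ℝ := Set.IccExtend hab ((Set.Icc a b).domRestrict u) with hv
  have hvc : Continuous v := (continuousOn_iff_continuous_domRestrict.1 hu).Icc_extend'
  have hvu : ∀ s ∈ Set.Icc a b, v s = u s := fun s hs => by
    rw [hv, Set.IccExtend_of_mem hab _ hs]; rfl
  refine ⟨fun s => ∫ r in a..s, v r, fun s hs => ?_, fun p hp q hq => ?_⟩
  · rw [← hvu s hs]
    exact (hvc.integral_hasStrictDerivAt a s).hasDerivAt.hasDerivWithinAt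
  · rw [intervalIntegral.integral_interval_sub_left (hvc.intervalIntegrable _ _)
      (hvc.intervalIntegrable _ _)]
    exact intervalIntegral.integral_congr fun s hs =>
      (hvu s ((Set.ordConnected_Icc.uIcc_subset hp hq) hs)).symm

lemma abs_le_mul_pow_succ_of_hasDerivWithinAt {a b p c : ℝ} {k : ℕ} {R R' : ℝ → ℝ}
    (hc : 0 ≤ c) (hp : p ∈ Set.Icc a b) (hRp : R p = 0)
    (hd : ∀ s ∈ Set.Icc a b, HasDerivWithinAt R (R' s) (Set.Icc a b) s)
    (hb : ∀ s ∈ Set.Icc a b, |R' s| ≤ c * |s - p| ^ k) :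
    ∀ s ∈ Set.Icc a b, |R s| ≤ c * |s - p| ^ (k + 1) := by
  intro s hs
  have hsub : Set.uIcc p s ⊆ Set.Icc a b := Set.ordConnected_Icc.uIcc_subset hp hs
  have := (convex_uIcc p s).norm_image_sub_le_of_norm_hasDerivWithin_le
    (f := R) (f' := R') (C := c * |s - p| ^ k)
    (fun z hz => (hd z (hsub hz)).mono hsub)
    (fun z hz => (hb z (hsub hz)).trans
      (by
        have := Set.abs_sub_left_of_mem_uIcc hz
        gcongr))
    Set.left_mem_uIcc Set.right_mem_uIcc
  rw [hRp, sub_zero, Real.norm_eq_abs, Real.norm_eq_abs] at this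
  rw [pow_succ, ← mul_assoc]
  exact this

/-- `H₁` and `H₂` are the first and second derivatives of `H` with respect to `F`, and `J` is
the primitive of `H` with respect to `F`, on `[a,b]`, where `F` has the density `f`, which is
bounded by `M`, and `H₂` is `L`-Lipschitz. -/
structure DerivChain (a b M L : ℝ) (f F J H H₁ H₂ : ℝ → ℝ) : Prop where
  M_nonneg : 0 ≤ M
  L_nonneg : 0 ≤ L
  bound : ∀ s ∈ Set.Icc a b, |f s| ≤ M
  deriv_F : ∀ s ∈ Set.Icc a b, HasDerivWithinAt F (f s) (Set.Icc a b) s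
  deriv_J : ∀ s ∈ Set.Icc a b, HasDerivWithinAt J (f s * H s) (Set.Icc a b) s
  deriv_H : ∀ s ∈ Set.Icc a b, HasDerivWithinAt H (f s * H₁ s) (Set.Icc a b) s
  deriv_H₁ : ∀ s ∈ Set.Icc a b, HasDerivWithinAt H₁ (f s * H₂ s) (Set.Icc a b) s
  lip : ∀ s ∈ Set.Icc a b, ∀ r ∈ Set.Icc a b, |H₂ s - H₂ r| ≤ L * |s - r|

namespace DerivChain

variable {a b M L : ℝ} {f F J H H₁ H₂ : ℝ → ℝ}

lemma taylor_one (D : DerivChain a b M L f F J H H₁ H₂) {p s : ℝ}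
    (hp : p ∈ Set.Icc a b) (hs : s ∈ Set.Icc a b) :
    |H₁ s - H₁ p - H₂ p * (F s - F p)| ≤ M * L * |s - p| ^ 2 := by
  have hM := D.M_nonneg
  have hL := D.L_nonneg
  refine abs_le_mul_pow_succ_of_hasDerivWithinAt (k := 1)
    (R := fun s => H₁ s - H₁ p - H₂ p * (F s - F p))
    (R' := fun s => f s * (H₂ s - H₂ p)) (by positivity) hp (by simp) (fun z hz => ?_)
    (fun z hz => ?_) s hs
  · refine (((D.deriv_H₁ z hz).sub_const (H₁ p)).sub
      (((D.deriv_F z hz).sub_const (F p)).const_mul (H₂ p))).congr_deriv ?_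
    ring
  · rw [abs_mul, pow_one, mul_assoc]
    exact mul_le_mul (D.bound z hz) (D.lip z hz p hp) (abs_nonneg _) hM

lemma taylor_two (D : DerivChain a b M L f F J H H₁ H₂) {p s : ℝ}
    (hp : p ∈ Set.Icc a b) (hs : s ∈ Set.Icc a b) :
    |H s - H p - H₁ p * (F s - F p) - H₂ p / 2 * (F s - F p) ^ 2|
      ≤ M ^ 2 * L * |s - p| ^ 3 := by
  have hM := D.M_nonneg
  have hL := D.L_nonneg
  refine abs_le_mul_pow_succ_of_hasDerivWithinAt (k := 2)
    (R := fun s => H s - H p - H₁ p * (F s - F p) - H₂ p / 2 * (F s - F p) ^ 2)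
    (R' := fun s => f s * (H₁ s - H₁ p - H₂ p * (F s - F p))) (by positivity) hp (by simp)
    (fun z hz => ?_) (fun z hz => ?_) s hs
  · have dF := (D.deriv_F z hz).sub_const (F p)
    refine ((((D.deriv_H z hz).sub_const (H p)).sub (dF.const_mul (H₁ p))).sub
      ((dF.pow 2).const_mul (H₂ p / 2))).congr_deriv ?_
    push_cast
    ring
  · rw [abs_mul, pow_two M, mul_assoc, mul_assoc, ← mul_assoc M L]
    exact mul_le_mul (D.bound z hz) (D.taylor_one hp hz) (abs_nonneg _) hM

lemma taylor_three (D : DerivChain a b M L f F J H H₁ H₂) {p s : ℝ}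
    (hp : p ∈ Set.Icc a b) (hs : s ∈ Set.Icc a b) :
    |J s - J p - H p * (F s - F p) - H₁ p / 2 * (F s - F p) ^ 2
        - H₂ p / 6 * (F s - F p) ^ 3| ≤ M ^ 3 * L * |s - p| ^ 4 := by
  have hM := D.M_nonneg
  have hL := D.L_nonneg
  refine abs_le_mul_pow_succ_of_hasDerivWithinAt (k := 3)
    (R := fun s => J s - J p - H p * (F s - F p) - H₁ p / 2 * (F s - F p) ^ 2
      - H₂ p / 6 * (F s - F p) ^ 3)
    (R' := fun s => f s * (H s - H p - H₁ p * (F s - F p) - H₂ p / 2 * (F s - F p) ^ 2))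
    (by positivity) hp (by simp) (fun z hz => ?_) (fun z hz => ?_) s hs
  · have dF := (D.deriv_F z hz).sub_const (F p)
    refine (((((D.deriv_J z hz).sub_const (J p)).sub (dF.const_mul (H p))).sub
      ((dF.pow 2).const_mul (H₁ p / 2))).sub ((dF.pow 3).const_mul (H₂ p / 6))).congr_deriv ?_
    push_cast
    ring
  · rw [abs_mul, show M ^ 3 * L * |z - p| ^ 3 = M * (M ^ 2 * L * |z - p| ^ 3) by ring]
    exact mul_le_mul (D.bound z hz) (D.taylor_two hp hz) (abs_nonneg _) hM

lemma abs_F_sub_le (D : DerivChain a b M L f F J H H₁ H₂) {p s : ℝ}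
    (hp : p ∈ Set.Icc a b) (hs : s ∈ Set.Icc a b) : |F s - F p| ≤ M * |s - p| :=
  (convex_Icc a b).norm_image_sub_le_of_norm_hasDerivWithin_le D.deriv_F D.bound hp hs

/-- The trapezoidal rule on a single cell, with the Euler–Maclaurin correction. -/
lemma trapezoid_cell (D : DerivChain a b M L f F J H H₁ H₂) {p s d : ℝ}
    (hp : p ∈ Set.Icc a b) (hs : s ∈ Set.Icc a b) (hd : |s - p| ≤ d) :
    |(F s - F p) / 2 * (H p + H s) - (J s - J p) - (F s - F p) ^ 2 / 12 * (H₁ s - H₁ p)|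
      ≤ 2 * M ^ 3 * L * d ^ 4 := by
  have hM := D.M_nonneg
  have hL := D.L_nonneg
  have h1 := D.taylor_one hp hs
  have h2 := D.taylor_two hp hs
  have h3 := D.taylor_three hp hs
  have h0 := D.abs_F_sub_le hp hs
  set δ := F s - F p
  set e := |s - p|
  have he : 0 ≤ e := abs_nonneg _
  set R₁ := H₁ s - H₁ p - H₂ p * δ with hR₁
  set R₂ := H s - H p - H₁ p * δ - H₂ p / 2 * δ ^ 2 with hR₂
  set R₃ := J s - J p - H p * δ - H₁ p / 2 * δ ^ 2 - H₂ p / 6 * δ ^ 3 with hR₃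
  have key : δ / 2 * (H p + H s) - (J s - J p) - δ ^ 2 / 12 * (H₁ s - H₁ p)
      = δ * R₂ / 2 - R₃ - δ ^ 2 * R₁ / 12 := by
    rw [hR₁, hR₂, hR₃]; ring
  have b2 : |δ * R₂| ≤ M ^ 3 * L * e ^ 4 := by
    rw [abs_mul]
    exact (mul_le_mul h0 h2 (abs_nonneg _) (by positivity)).trans (le_of_eq (by ring))
  have b1 : |δ ^ 2 * R₁| ≤ M ^ 3 * L * e ^ 4 := by
    rw [abs_mul, abs_pow]
    exact (mul_le_mul (pow_le_pow_left₀ (abs_nonneg _) h0 2) h1 (abs_nonneg _)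
      (by positivity)).trans (le_of_eq (by ring))
  have hde : M ^ 3 * L * e ^ 4 ≤ M ^ 3 * L * d ^ 4 := by gcongr
  rw [key]
  rw [abs_le] at *
  constructor <;> linarith [b1.1, b1.2, b2.1, b2.2, h3.1, h3.2]

/-- The composite trapezoidal rule with nodes that are equidistant in `F`, for an integrand that
vanishes to second order at both ends of the interval. -/
lemma trapezoid_composite (D : DerivChain a b M L f F J H H₁ H₂) {η d : ℝ} {τ : ℕ → ℝ}
    {m k : ℕ} (hmk : m ≤ k)
    (hτ : ∀ i, m ≤ i → i ≤ k → τ i ∈ Set.Icc a b)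
    (hF : ∀ i, m ≤ i → i < k → F (τ (i + 1)) - F (τ i) = η)
    (hd : ∀ i, m ≤ i → i < k → |τ (i + 1) - τ i| ≤ d)
    (hda : |τ m - a| ≤ d) (hdb : |τ k - b| ≤ d)
    (ha : H a = 0 ∧ H₁ a = 0 ∧ H₂ a = 0) (hb : H b = 0 ∧ H₁ b = 0 ∧ H₂ b = 0) :
    |η / 2 * ∑ i ∈ Finset.Ico m k, (H (τ i) + H (τ (i + 1))) - (J b - J a)|
      ≤ ((k : ℝ) - m) * (2 * M ^ 3 * L * d ^ 4) + η ^ 2 * (M * L * d ^ 2)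
        + 2 * (M ^ 3 * L * d ^ 4) := by
  have hM := D.M_nonneg
  have hL := D.L_nonneg
  have mm := hτ m le_rfl hmk
  have mk := hτ k hmk le_rfl
  have hab : a ≤ b := mm.1.trans mm.2
  have ma : a ∈ Set.Icc a b := Set.left_mem_Icc.2 hab
  have mb : b ∈ Set.Icc a b := Set.right_mem_Icc.2 hab
  have ja := D.taylor_three ma mm
  have jb := D.taylor_three mb mk
  have ka := D.taylor_one ma mm
  have kb := D.taylor_one mb mk
  rw [ha.1, ha.2.1, ha.2.2] at ja
  rw [hb.1, hb.2.1, hb.2.2] at jb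
  rw [ha.2.1, ha.2.2] at ka
  rw [hb.2.1, hb.2.2] at kb
  simp only [zero_mul, zero_div, sub_zero] at ja jb ka kb
  have e1 : M ^ 3 * L * |τ m - a| ^ 4 ≤ M ^ 3 * L * d ^ 4 := by gcongr
  have e2 : M ^ 3 * L * |τ k - b| ^ 4 ≤ M ^ 3 * L * d ^ 4 := by gcongr
  have e3 : M * L * |τ m - a| ^ 2 ≤ M * L * d ^ 2 := by gcongr
  have e4 : M * L * |τ k - b| ^ 2 ≤ M * L * d ^ 2 := by gcongr
  have cells : |∑ i ∈ Finset.Ico m k, (η / 2 * (H (τ i) + H (τ (i + 1)))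
      - (J (τ (i + 1)) - J (τ i)) - η ^ 2 / 12 * (H₁ (τ (i + 1)) - H₁ (τ i)))|
      ≤ ((k : ℝ) - m) * (2 * M ^ 3 * L * d ^ 4) := by
    refine (Finset.abs_sum_le_sum_abs _ _).trans ?_
    refine (Finset.sum_le_card_nsmul _ _ (2 * M ^ 3 * L * d ^ 4) fun i hi => ?_).trans ?_
    · obtain ⟨h1, h2⟩ := Finset.mem_Ico.1 hi
      have := D.trapezoid_cell (hτ i h1 h2.le) (hτ (i + 1) (by omega) (by omega)) (hd i h1 h2)
      rwa [hF i h1 h2] at this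
    · rw [nsmul_eq_mul, Nat.card_Ico, Nat.cast_sub hmk]
  rw [Finset.sum_sub_distrib, Finset.sum_sub_distrib, ← Finset.mul_sum, ← Finset.mul_sum,
    Finset.sum_Ico_sub (fun i => J (τ i)) hmk, Finset.sum_Ico_sub (fun i => H₁ (τ i)) hmk] at cells
  have corr : |η ^ 2 / 12 * (H₁ (τ k) - H₁ (τ m))| ≤ η ^ 2 * (M * L * d ^ 2) := by
    rw [abs_mul, abs_of_nonneg (by positivity)]
    have h2 : |H₁ (τ k) - H₁ (τ m)| ≤ 2 * (M * L * d ^ 2) :=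
      (abs_sub _ _).trans (by linarith)
    have h3 : 0 ≤ M * L * d ^ 2 := by positivity
    nlinarith [mul_le_mul_of_nonneg_left h2 (sq_nonneg η), mul_nonneg (sq_nonneg η) h3]
  rw [abs_le] at *
  constructor <;> linarith [cells.1, cells.2, corr.1, corr.2, ja.1, ja.2, jb.1, jb.2]

end DerivChain

lemma eqOn_deriv_zero_compl_Icc {v : ℝ → ℝ} {a b : ℝ} (hv : ∀ u, u ∉ Set.Icc a b → v u = 0) :
    ∀ u, u ∉ Set.Icc a b → deriv v u = 0 := by
  intro u hu
  have : v =ᶠ[nhds u] fun _ => 0 := by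
    filter_upwards [isClosed_Icc.isOpen_compl.mem_nhds hu] with z hz using hv z hz
  rw [this.deriv_eq, deriv_const]

lemma eq_zero_endpoints_of_eqOn_compl_Icc {v : ℝ → ℝ} {a b : ℝ} (hc : Continuous v)
    (hv : ∀ u, u ∉ Set.Icc a b → v u = 0) : v b = 0 ∧ v a = 0 := by
  have hcl : IsClosed {u | v u = 0} := isClosed_eq hc continuous_const
  constructor
  · have h : closure (Set.Ioi b) ⊆ {u | v u = 0} :=
      hcl.closure_subset_iff.2 fun u hu => hv u fun h => absurd h.2 (not_le.2 hu)
    rw [closure_Ioi] at h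
    exact h Set.self_mem_Ici
  · have h : closure (Set.Iio a) ⊆ {u | v u = 0} :=
      hcl.closure_subset_iff.2 fun u hu => hv u fun h => absurd h.1 (not_le.2 hu)
    rw [closure_Iio] at h
    exact h Set.self_mem_Iic

lemma sub_div_mem_Icc {x h s : ℝ} (hh : 0 < h) (hs : s ∈ Set.Icc (x - h) (x + h)) :
    (x - s) / h ∈ Set.Icc (-1 : ℝ) 1 :=
  ⟨by rw [le_div_iff₀ hh]; linarith [hs.2], by rw [div_le_iff₀ hh]; linarith [hs.1]⟩

/-- A rescaled Lipschitz function times a fixed Lipschitz function has Lipschitz constant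
of order `1 / h`. -/
lemma BddLipOn.exists_lip_rescale_mul {k A : ℝ → ℝ} (hk : BddLipOn (Set.Icc (-1) 1) k)
    (hA : BddLipOn (Set.Icc 0 1) A) (x : ℝ) :
    ∃ B : ℝ, 0 ≤ B ∧ ∀ h : ℝ, 0 < h → h < 1 → Set.Icc (x - h) (x + h) ⊆ Set.Icc (0:ℝ) 1 →
      ∀ s ∈ Set.Icc (x - h) (x + h), ∀ r ∈ Set.Icc (x - h) (x + h),
        |k ((x - s) / h) * A s - k ((x - r) / h) * A r| ≤ B / h * |s - r| := by
  obtain ⟨M, hM, k1, k2⟩ := hk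
  obtain ⟨N, hN, a1, a2⟩ := hA
  refine ⟨2 * (M * N), by positivity, fun h h0 h1 hsub s hs r hr => ?_⟩
  have ms := sub_div_mem_Icc h0 hs
  have mr := sub_div_mem_Icc h0 hr
  refine (abs_mul_sub_mul_le (a1 s (hsub hs)) (k1 _ mr) (k2 _ ms _ mr)
    (a2 s (hsub hs) r (hsub hr))).trans ?_
  have e : |(x - s) / h - (x - r) / h| = |s - r| / h := by
    rw [← sub_div, abs_div, abs_of_pos h0, abs_sub_comm s r]; ring_nf
  rw [e]
  have : |s - r| ≤ |s - r| / h := by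
    rw [le_div_iff₀ h0]; nlinarith [abs_nonneg (s - r)]
  calc M * (|s - r| / h) * N + M * (N * |s - r|)
      ≤ M * (|s - r| / h) * N + M * (N * (|s - r| / h)) := by gcongr
    _ = _ := by ring

/-- The first two derivatives of `phiK K x h * g / f` with respect to the cdf of `f`, with
Lipschitz constant of order `1 / h ^ 4` for the second one. -/
lemma exists_derivChain_phiK {f f₁ f₂ g g₁ g₂ K K₁ K₂ F : ℝ → ℝ} {c : ℝ} (hc : 0 < c)
    (hlb : ∀ s ∈ Set.Icc (0:ℝ) 1, c ≤ f s)
    (df : ∀ s ∈ Set.Icc (0:ℝ) 1, HasDerivWithinAt f (f₁ s) (Set.Icc 0 1) s)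
    (df₁ : ∀ s ∈ Set.Icc (0:ℝ) 1, HasDerivWithinAt f₁ (f₂ s) (Set.Icc 0 1) s)
    (bf : BddLipOn (Set.Icc 0 1) f) (bf₁ : BddLipOn (Set.Icc 0 1) f₁)
    (bf₂ : BddLipOn (Set.Icc 0 1) f₂)
    (dg : ∀ s ∈ Set.Icc (0:ℝ) 1, HasDerivWithinAt g (g₁ s) (Set.Icc 0 1) s)
    (dg₁ : ∀ s ∈ Set.Icc (0:ℝ) 1, HasDerivWithinAt g₁ (g₂ s) (Set.Icc 0 1) s)
    (bg : BddLipOn (Set.Icc 0 1) g) (bg₁ : BddLipOn (Set.Icc 0 1) g₁)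
    (bg₂ : BddLipOn (Set.Icc 0 1) g₂)
    (dK : ∀ u, HasDerivAt K (K₁ u) u) (dK₁ : ∀ u, HasDerivAt K₁ (K₂ u) u)
    (bK : BddLipOn (Set.Icc (-1) 1) K) (bK₁ : BddLipOn (Set.Icc (-1) 1) K₁)
    (bK₂ : BddLipOn (Set.Icc (-1) 1) K₂)
    (zK : K 1 = 0 ∧ K (-1) = 0) (zK₁ : K₁ 1 = 0 ∧ K₁ (-1) = 0) (zK₂ : K₂ 1 = 0 ∧ K₂ (-1) = 0)
    (dF : ∀ s ∈ Set.Icc (0:ℝ) 1, HasDerivWithinAt F (f s) (Set.Icc 0 1) s) (x : ℝ) :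
    ∃ M B : ℝ, 0 ≤ M ∧ 0 ≤ B ∧ ∀ h : ℝ, 0 < h → h < 1 →
      Set.Icc (x - h) (x + h) ⊆ Set.Icc (0:ℝ) 1 →
      ∃ J H H₁ H₂ : ℝ → ℝ, H = (fun s => phiK K x h s * g s / f s) ∧
        DerivChain (x - h) (x + h) M (B / h ^ 4) f F J H H₁ H₂ ∧
        ∫ s in (x - h)..(x + h), phiK K x h s * g s = J (x + h) - J (x - h) ∧
        (H (x - h) = 0 ∧ H₁ (x - h) = 0 ∧ H₂ (x - h) = 0) ∧
        (H (x + h) = 0 ∧ H₁ (x + h) = 0 ∧ H₂ (x + h) = 0) := by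
  have bw : BddLipOn (Set.Icc 0 1) fun s => (f s)⁻¹ := bf.inv hc hlb
  set w : ℝ → ℝ := fun s => (f s)⁻¹ with hw
  have fpos : ∀ s ∈ Set.Icc (0:ℝ) 1, 0 < f s := fun s hs => hc.trans_le (hlb s hs)
  have fw : ∀ s ∈ Set.Icc (0:ℝ) 1, f s * w s = 1 := fun s hs => mul_inv_cancel₀ (fpos s hs).ne'
  have dw : ∀ s ∈ Set.Icc (0:ℝ) 1, HasDerivWithinAt w (-f₁ s * w s ^ 2) (Set.Icc 0 1) s := by
    intro s hs
    refine ((df s hs).inv (fpos s hs).ne').congr_deriv ?_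
    simp only [hw]
    field_simp
  obtain ⟨M, hM, hfM, _⟩ := bf
  set A₂ : ℝ → ℝ := fun s => g s * w s ^ 3 with hA₂
  set A₁ : ℝ → ℝ := fun s => 2 * (g₁ s * w s ^ 3) + (-3) * (g s * f₁ s * w s ^ 4) with hA₁
  set A₀ : ℝ → ℝ := fun s => g₂ s * w s ^ 3 + (-3) * (g₁ s * f₁ s * w s ^ 4)
    + (-1) * (g s * f₂ s * w s ^ 4) + 3 * (g s * f₁ s ^ 2 * w s ^ 5) with hA₀
  have bA₂ : BddLipOn (Set.Icc 0 1) A₂ := bg.mul (bw.pow 3)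
  have bA₁ : BddLipOn (Set.Icc 0 1) A₁ :=
    ((BddLipOn.const 2).mul (bg₁.mul (bw.pow 3))).add
      ((BddLipOn.const (-3)).mul ((bg.mul bf₁).mul (bw.pow 4)))
  have bA₀ : BddLipOn (Set.Icc 0 1) A₀ :=
    (((bg₂.mul (bw.pow 3)).add
      ((BddLipOn.const (-3)).mul ((bg₁.mul bf₁).mul (bw.pow 4)))).add
      ((BddLipOn.const (-1)).mul ((bg.mul bf₂).mul (bw.pow 4)))).add
      ((BddLipOn.const 3).mul ((bg.mul (bf₁.pow 2)).mul (bw.pow 5)))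
  obtain ⟨B₀, hB₀, l₀⟩ := bK.exists_lip_rescale_mul bA₀ x
  obtain ⟨B₁, hB₁, l₁⟩ := bK₁.exists_lip_rescale_mul bA₁ x
  obtain ⟨B₂, hB₂, l₂⟩ := bK₂.exists_lip_rescale_mul bA₂ x
  refine ⟨M, B₀ + B₁ + B₂, hM, by positivity, fun h h0 h1 hsub => ?_⟩
  have hab : x - h ≤ x + h := by linarith
  set W := Set.Icc (x - h) (x + h)
  have darg : ∀ s, HasDerivAt (fun s => (x - s) / h) (-h⁻¹) s := fun s =>
    (((hasDerivAt_id s).const_sub x).div_const h).congr_deriv (by field_simp)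
  set k₀ : ℝ → ℝ := fun s => K ((x - s) / h) with hk₀
  set k₁ : ℝ → ℝ := fun s => K₁ ((x - s) / h) with hk₁
  set k₂ : ℝ → ℝ := fun s => K₂ ((x - s) / h) with hk₂
  have dk₀ : ∀ s, HasDerivWithinAt k₀ (k₁ s * (-h⁻¹)) W s := fun s =>
    ((dK _).comp s (darg s)).hasDerivWithinAt
  have dk₁ : ∀ s, HasDerivWithinAt k₁ (k₂ s * (-h⁻¹)) W s := fun s =>
    ((dK₁ _).comp s (darg s)).hasDerivWithinAt
  have cont : ContinuousOn (fun s => phiK K x h s * g s) W := by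
    have c1 : ContinuousOn k₀ W := fun s _ => (dk₀ s).continuousWithinAt
    have c2 : ContinuousOn g W := fun s hs => ((dg s (hsub hs)).mono hsub).continuousWithinAt
    exact (continuousOn_const.mul c1).mul c2
  obtain ⟨J, dJ, hJ⟩ := exists_primitive_of_continuousOn_Icc hab cont
  refine ⟨J, fun s => phiK K x h s * g s / f s,
    fun s => -h⁻¹ ^ 2 * k₁ s * (g s * w s ^ 2)
      + h⁻¹ * k₀ s * (g₁ s * w s ^ 2 - g s * f₁ s * w s ^ 3),
    fun s => h⁻¹ ^ 3 * (k₂ s * A₂ s) - h⁻¹ ^ 2 * (k₁ s * A₁ s) + h⁻¹ * (k₀ s * A₀ s),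
    rfl, ⟨hM, by positivity, fun s hs => hfM s (hsub hs),
      fun s hs => (dF s (hsub hs)).mono hsub, fun s hs => ?_, fun s hs => ?_, fun s hs => ?_,
      fun s hs r hr => ?_⟩,
    hJ _ (Set.left_mem_Icc.2 hab) _ (Set.right_mem_Icc.2 hab), ?_, ?_⟩
  · refine (dJ s hs).congr_deriv ?_
    have := (fpos s (hsub hs)).ne'
    field_simp
  · have hs' := hsub hs
    have e := fw s hs'
    refine ((((dk₀ s).const_mul h⁻¹).mul ((dg s hs').mono hsub)).mul
      ((dw s hs').mono hsub)).congr (f₁ := fun s => phiK K x h s * g s / f s)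
        (fun z _ => ?_) ?_ |>.congr_deriv ?_
    · simp [phiK, hw, hk₀, div_eq_mul_inv]
    · simp [phiK, hw, hk₀, div_eq_mul_inv]
    · simp only [Pi.mul_apply]
      linear_combination (h⁻¹ ^ 2 * k₁ s * g s * w s - h⁻¹ * k₀ s * g₁ s * w s
        + h⁻¹ * k₀ s * g s * f₁ s * w s ^ 2) * e
  · have hs' := hsub hs
    have e := fw s hs'
    have ew := (dw s hs').mono hsub
    have eg := (dg s hs').mono hsub
    have eg₁ := (dg₁ s hs').mono hsub
    have ef₁ := (df₁ s hs').mono hsub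
    refine ((((dk₁ s).const_mul (-h⁻¹ ^ 2)).mul (eg.mul (ew.pow 2))).add
      (((dk₀ s).const_mul h⁻¹).mul ((eg₁.mul (ew.pow 2)).sub
        ((eg.mul ef₁).mul (ew.pow 3))))).congr_deriv ?_
    simp only [Pi.mul_apply, Pi.pow_apply, Pi.sub_apply, hA₀, hA₁, hA₂]
    push_cast
    linear_combination (-(h⁻¹ ^ 3 * k₂ s * (g s * w s ^ 2))
      + h⁻¹ ^ 2 * k₁ s * (2 * (g₁ s * w s ^ 2) - 3 * (g s * f₁ s * w s ^ 3))
      - h⁻¹ * k₀ s * (g₂ s * w s ^ 2 - 3 * (g₁ s * f₁ s * w s ^ 3) - g s * f₂ s * w s ^ 3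
        + 3 * (g s * f₁ s ^ 2 * w s ^ 4))) * e
  · have q₀ := l₀ h h0 h1 hsub s hs r hr
    have q₁ := l₁ h h0 h1 hsub s hs r hr
    have q₂ := l₂ h h0 h1 hsub s hs r hr
    have hi : 1 ≤ h⁻¹ := (one_le_inv₀ h0).2 h1.le
    have term : ∀ (j : ℕ) (y B : ℝ), j ≤ 3 → |y| ≤ B / h * |s - r| →
        |h⁻¹ ^ j * y| ≤ B * (h⁻¹ ^ 4 * |s - r|) := by
      intro j y B hj hy
      rw [abs_mul, abs_of_nonneg (by positivity)]
      calc h⁻¹ ^ j * |y| ≤ h⁻¹ ^ 3 * (B / h * |s - r|) :=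
            mul_le_mul (pow_le_pow_right₀ hi hj) hy (abs_nonneg _) (by positivity)
        _ = _ := by rw [div_eq_mul_inv]; ring
    have r₀ := term 1 _ _ (by norm_num) q₀
    have r₁ := term 2 _ _ (by norm_num) q₁
    have r₂ := term 3 _ _ (by norm_num) q₂
    rw [show (B₀ + B₁ + B₂) / h ^ 4 * |s - r| = B₀ * (h⁻¹ ^ 4 * |s - r|)
      + B₁ * (h⁻¹ ^ 4 * |s - r|) + B₂ * (h⁻¹ ^ 4 * |s - r|) by
        rw [div_eq_mul_inv, inv_pow]; ring]
    rw [abs_le] at r₀ r₁ r₂ ⊢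
    simp only [hk₀, hk₁, hk₂]
    constructor <;> linarith [r₀.1, r₀.2, r₁.1, r₁.2, r₂.1, r₂.2]
  · simp [phiK, hk₀, hk₁, hk₂, h0.ne', zK.1, zK₁.1, zK₂.1]
  · simp [phiK, hk₀, hk₁, hk₂, h0.ne', zK.2, zK₁.2, zK₂.2]

/-- The cells inside the window are consecutive, and they are maximal. -/
lemma trapIdx_eq_Ico {t : ℕ → ℕ → ℝ} {n : ℕ} {x h : ℝ} (hmono : StrictMonoOn (t n) (Set.Icc 1 n))
    (hne : (trapIdx t n x h).Nonempty) :
    ∃ m k : ℕ, 1 ≤ m ∧ m < k ∧ k ≤ n ∧ trapIdx t n x h = Finset.Ico m k ∧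
      (m = 1 ∨ 2 ≤ m ∧ t n (m - 1) < x - h) ∧ (k = n ∨ k < n ∧ x + h < t n (k + 1)) := by
  have mem : ∀ i, i ∈ trapIdx t n x h ↔ (1 ≤ i ∧ i + 1 ≤ n) ∧ x - h ≤ t n i ∧
      t n (i + 1) ≤ x + h := by
    intro i
    simp only [trapIdx, Finset.mem_filter, Finset.mem_Icc, Set.mem_Icc]
    constructor
    · rintro ⟨⟨h1, h2⟩, ⟨h3, _⟩, _, h6⟩
      exact ⟨⟨h1, by omega⟩, h3, h6⟩
    · rintro ⟨⟨h1, h2⟩, h3, h6⟩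
      have : t n i < t n (i + 1) :=
        hmono ⟨by omega, by omega⟩ ⟨by omega, by omega⟩ (Nat.lt_succ_self i)
      exact ⟨⟨h1, by omega⟩, ⟨h3, by linarith⟩, by linarith, h6⟩
  set m := (trapIdx t n x h).min' hne
  set l := (trapIdx t n x h).max' hne
  have mm := (mem m).1 (Finset.min'_mem _ _)
  have ml := (mem l).1 (Finset.max'_mem _ _)
  have hml : m ≤ l := Finset.min'_le_max' _ hne
  refine ⟨m, l + 1, mm.1.1, by omega, ml.1.2, ?_, ?_, ?_⟩
  · ext i
    rw [Finset.mem_Ico]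
    constructor
    · intro hi
      exact ⟨Finset.min'_le _ _ hi, Nat.lt_succ_of_le (Finset.le_max' _ _ hi)⟩
    · rintro ⟨h1, h2⟩
      refine (mem i).2 ⟨⟨by omega, by omega⟩, mm.2.1.trans ?_, le_trans ?_ ml.2.2⟩
      · exact hmono.monotoneOn ⟨by omega, by omega⟩ ⟨by omega, by omega⟩ h1
      · exact hmono.monotoneOn ⟨by omega, by omega⟩ ⟨by omega, by omega⟩ (by omega)
  · by_contra! hcon
    have h2 : 2 ≤ m := by have := hcon.1; omega
    have hin : m - 1 ∈ trapIdx t n x h := by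
      refine (mem _).2 ⟨⟨by omega, by omega⟩, hcon.2 h2, ?_⟩
      rw [Nat.sub_add_cancel mm.1.1]
      exact (hmono ⟨by omega, by omega⟩ ⟨by omega, by omega⟩
        (Nat.lt_succ_self m)).le.trans mm.2.2
    have := Finset.min'_le _ _ hin
    omega
  · by_contra! hcon
    have h2 : l + 1 < n := by have := hcon.1; omega
    have hin : l + 1 ∈ trapIdx t n x h := by
      refine (mem _).2 ⟨⟨by omega, by omega⟩, ?_, hcon.2 h2⟩
      exact ml.2.1.trans (hmono ⟨by omega, by omega⟩ ⟨by omega, by omega⟩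
        (Nat.lt_succ_self l)).le
    have := Finset.le_max' _ _ hin
    omega

/- STATEMENT 4: Under C² assumptions on g, f (with f'' , g'' Lipschitz,
   f a density with inf f > 0) and on the even kernel K supported in [−1,1]
   with K'' Lipschitz, for x ∈ (0,1) the trapezoidal-rule error
   Δ_{x,h} = (1/(2n)) Σ_{k=1}^{N−1}[(φ·g/f)(t_{x,k}) + (φ·g/f)(t_{x,k+1})]
             − ∫_{x−h}^{x+h} φ_{x,h} g
   satisfies |Δ_{x,h}| ≤ C/(n³h³) for all n ≥ 1, h ∈ (0,1) with nh ≥ 1,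
   N ≠ 0 and [x−h,x+h] ⊆ [0,1]. -/

theorem trapezoidal_rule_error_bound
    (f : ℝ → ℝ) (cf : ℝ) (hcf : 0 < cf)
    (hf_lb : ∀ s ∈ Set.Icc (0:ℝ) 1, cf ≤ f s)
    (hf_smooth : ContDiffOn ℝ 2 f (Set.Icc 0 1))
    (hf''_lip : ∃ L : NNReal,
      LipschitzOnWith L (iteratedDerivWithin 2 f (Set.Icc 0 1)) (Set.Icc 0 1))
    (hf_density : ∫ s in (0:ℝ)..1, f s = 1)
    (t : ℕ → ℕ → ℝ)
    (ht_mem : ∀ n i : ℕ, 1 ≤ i → i ≤ n → t n i ∈ Set.Icc (0:ℝ) 1)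
    (ht_def : ∀ n i : ℕ, 1 ≤ i → i ≤ n →
      ∫ s in (0:ℝ)..(t n i), f s = (i : ℝ) / n)
    (ht_mono : ∀ n : ℕ, StrictMonoOn (t n) (Set.Icc 1 n))
    (g : ℝ → ℝ)
    (hg_smooth : ContDiffOn ℝ 2 g (Set.Icc 0 1))
    (hg''_lip : ∃ L : NNReal,
      LipschitzOnWith L (iteratedDerivWithin 2 g (Set.Icc 0 1)) (Set.Icc 0 1))
    (K : ℝ → ℝ)
    (hK_even : ∀ u : ℝ, K (-u) = K u)
    (hK_supp : ∀ u : ℝ, u ∉ Set.Icc (-1:ℝ) 1 → K u = 0)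
    (hK_smooth : ContDiff ℝ 2 K)
    (hK''_lip : ∃ L : NNReal,
      LipschitzOnWith L (iteratedDeriv 2 K) (Set.Icc (-1:ℝ) 1))
    (x : ℝ) (hx : x ∈ Set.Ioo (0:ℝ) 1) :
    ∃ C : ℝ, 0 < C ∧
      ∀ (n : ℕ) (h : ℝ), 1 ≤ n → 0 < h → h < 1 → 1 ≤ (n : ℝ) * h →
        Set.Icc (x - h) (x + h) ⊆ Set.Icc (0:ℝ) 1 →
        (trapIdx t n x h).Nonempty →
        |trapSum t n x h (fun s => phiK K x h s * g s / f s)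
            - ∫ s in (x - h)..(x + h), phiK K x h s * g s|
          ≤ C / ((n : ℝ) ^ 3 * h ^ 3) := by
  obtain ⟨Lf, hLf⟩ := hf''_lip
  obtain ⟨Lg, hLg⟩ := hg''_lip
  obtain ⟨LK, hLK⟩ := hK''_lip
  obtain ⟨f₁, f₂, df, df₁, bf, bf₁, bf₂⟩ :=
    exists_derivs_of_contDiffOn_two zero_lt_one hf_smooth hLf
  obtain ⟨g₁, g₂, dg, dg₁, bg, bg₁, bg₂⟩ :=
    exists_derivs_of_contDiffOn_two zero_lt_one hg_smooth hLg
  have hK₁ : ContDiff ℝ 1 (deriv K) := ((contDiff_succ_iff_deriv (n := 1)).1 hK_smooth).2.2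
  have dK : ∀ u, HasDerivAt K (deriv K u) u := fun u =>
    (hK_smooth.differentiable (by norm_num) u).hasDerivAt
  have dK₁ : ∀ u, HasDerivAt (deriv K) (deriv (deriv K) u) u := fun u =>
    (hK₁.differentiable (by norm_num) u).hasDerivAt
  have hK₂ : Continuous (deriv (deriv K)) := hK₁.continuous_deriv le_rfl
  rw [iteratedDeriv_succ, iteratedDeriv_one] at hLK
  have bK₂ := BddLipOn.of_lipschitzOnWith hLK
  have bK₁ := BddLipOn.of_hasDerivWithinAt (fun s _ => (dK₁ s).hasDerivWithinAt) bK₂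
  have bK := BddLipOn.of_hasDerivWithinAt (fun s _ => (dK s).hasDerivWithinAt) bK₁
  have sK₁ := eqOn_deriv_zero_compl_Icc hK_supp
  have sK₂ := eqOn_deriv_zero_compl_Icc sK₁
  obtain ⟨F, dF, hF⟩ := exists_primitive_of_continuousOn_Icc zero_le_one hf_smooth.continuousOn
  obtain ⟨M, B, hM, hB, hchain⟩ := exists_derivChain_phiK hcf hf_lb df df₁ bf bf₁ bf₂ dg dg₁
    bg bg₁ bg₂ dK dK₁ bK bK₁ bK₂
    (eq_zero_endpoints_of_eqOn_compl_Icc hK_smooth.continuous hK_supp)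
    (eq_zero_endpoints_of_eqOn_compl_Icc hK₁.continuous sK₁)
    (eq_zero_endpoints_of_eqOn_compl_Icc hK₂ sK₂) dF x
  have z0 : (0:ℝ) ∈ Set.Icc (0:ℝ) 1 := Set.left_mem_Icc.2 zero_le_one
  have z1 : (1:ℝ) ∈ Set.Icc (0:ℝ) 1 := Set.right_mem_Icc.2 zero_le_one
  have Flow : ∀ p ∈ Set.Icc (0:ℝ) 1, ∀ q ∈ Set.Icc (0:ℝ) 1, p ≤ q →
      cf * (q - p) ≤ F q - F p := by
    intro p hp q hq hpq
    have hsub : Set.Icc p q ⊆ Set.Icc (0:ℝ) 1 := Set.Icc_subset_Icc hp.1 hq.2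
    rw [← hF p hp q hq, mul_comm, ← smul_eq_mul, ← intervalIntegral.integral_const]
    exact intervalIntegral.integral_mono_on hpq intervalIntegrable_const
      ((hf_smooth.continuousOn.mono hsub).intervalIntegrable_of_Icc hpq)
      fun s hs => hf_lb s (hsub hs)
  have Fmono : ∀ p ∈ Set.Icc (0:ℝ) 1, ∀ q ∈ Set.Icc (0:ℝ) 1, p ≤ q → F p ≤ F q :=
    fun p hp q hq hpq => by
      linarith [Flow p hp q hq hpq, mul_nonneg hcf.le (sub_nonneg.2 hpq)]
  have F1 : F 1 - F 0 = 1 := by rw [← hF 0 z0 1 z1, hf_density]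
  refine ⟨4 * M ^ 4 * cf⁻¹ ^ 4 * B + M * cf⁻¹ ^ 2 * B + 2 * M ^ 3 * cf⁻¹ ^ 4 * B + 1,
    by positivity, fun n h hn h0 h1 hnh hsub hne => ?_⟩
  have n0 : (0:ℝ) < n := by exact_mod_cast hn
  obtain ⟨J, H, H₁, H₂, hH, D, hJ, va, vb⟩ := hchain h h0 h1 hsub
  obtain ⟨m, k, hm, hmk, hkn, hidx, hleft, hright⟩ := trapIdx_eq_Ico (ht_mono n) hne
  have hmem : ∀ i, m ≤ i → i ≤ k → t n i ∈ Set.Icc (x - h) (x + h) := by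
    intro i h1 h2
    rcases h2.lt_or_eq with h2 | rfl
    · have : i ∈ trapIdx t n x h := by rw [hidx]; exact Finset.mem_Ico.2 ⟨h1, h2⟩
      exact (Finset.mem_filter.1 this).2.1
    · obtain ⟨j, rfl⟩ : ∃ j, i = j + 1 := ⟨i - 1, by omega⟩
      have : j ∈ trapIdx t n x h := by rw [hidx]; exact Finset.mem_Ico.2 ⟨by omega, by omega⟩
      exact (Finset.mem_filter.1 this).2.2
  have Ft : ∀ i, 1 ≤ i → i ≤ n → F (t n i) = F 0 + i / n := fun i h1 h2 => by
    have := hF 0 z0 _ (ht_mem n i h1 h2)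
    rw [ht_def n i h1 h2] at this
    linarith
  have dist_le : ∀ p ∈ Set.Icc (0:ℝ) 1, ∀ q ∈ Set.Icc (0:ℝ) 1, p ≤ q →
      F q - F p ≤ 1 / n → q - p ≤ cf⁻¹ / n := by
    intro p hp q hq hpq hle
    have := (Flow p hp q hq hpq).trans hle
    rw [mul_comm, ← le_div_iff₀ hcf] at this
    exact this.trans (le_of_eq (by field_simp))
  have ma := hsub (Set.left_mem_Icc.2 (by linarith : x - h ≤ x + h))
  have mb := hsub (Set.right_mem_Icc.2 (by linarith : x - h ≤ x + h))
  have Fstep : ∀ i, m ≤ i → i < k → F (t n (i + 1)) - F (t n i) = 1 / n := fun i h1 h2 => by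
    rw [Ft i (by omega) (by omega), Ft (i + 1) (by omega) (by omega)]
    push_cast
    ring
  have main := D.trapezoid_composite (η := 1 / n) (d := cf⁻¹ / n) (τ := t n) hmk.le hmem
    Fstep (fun i h1 h2 => ?_) ?_ ?_ va vb
  · rw [← hH, trapSum, hidx, hJ, show 1 / (2 * (n:ℝ)) = 1 / n / 2 by field_simp]
    refine main.trans ?_
    have count : (k : ℝ) - m ≤ M * (2 * h) * n := by
      have e1 := D.abs_F_sub_le (hmem m le_rfl hmk.le) (hmem k hmk.le le_rfl)
      rw [Ft m hm (by omega), Ft k (by omega) hkn] at e1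
      have e2 : |t n k - t n m| ≤ 2 * h := by
        have hm' := hmem m le_rfl hmk.le
        have hk' := hmem k hmk.le le_rfl
        rw [abs_le]
        constructor <;> linarith [hm'.1, hm'.2, hk'.1, hk'.2]
      have e3 : ((k : ℝ) - m) / n ≤ M * (2 * h) := by
        calc ((k : ℝ) - m) / n = F 0 + k / n - (F 0 + m / n) := by ring
          _ ≤ _ := le_abs_self _
          _ ≤ _ := e1
          _ ≤ _ := by gcongr
      rwa [div_le_iff₀ n0] at e3
    have hpow : 1 / ((n:ℝ) ^ 4 * h ^ 4) ≤ 1 / ((n:ℝ) ^ 3 * h ^ 3) := by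
      rw [← mul_pow, ← mul_pow]
      exact one_div_le_one_div_of_le (by positivity) (pow_le_pow_right₀ hnh (by norm_num))
    calc ((k : ℝ) - m) * (2 * M ^ 3 * (B / h ^ 4) * (cf⁻¹ / n) ^ 4)
          + (1 / (n:ℝ)) ^ 2 * (M * (B / h ^ 4) * (cf⁻¹ / n) ^ 2)
          + 2 * (M ^ 3 * (B / h ^ 4) * (cf⁻¹ / n) ^ 4)
        ≤ M * (2 * h) * n * (2 * M ^ 3 * (B / h ^ 4) * (cf⁻¹ / n) ^ 4)
          + (1 / (n:ℝ)) ^ 2 * (M * (B / h ^ 4) * (cf⁻¹ / n) ^ 2)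
          + 2 * (M ^ 3 * (B / h ^ 4) * (cf⁻¹ / n) ^ 4) := by gcongr
      _ = 4 * M ^ 4 * cf⁻¹ ^ 4 * B * (1 / ((n:ℝ) ^ 3 * h ^ 3))
          + (M * cf⁻¹ ^ 2 * B + 2 * M ^ 3 * cf⁻¹ ^ 4 * B) * (1 / ((n:ℝ) ^ 4 * h ^ 4)) := by
        field_simp
        ring
      _ ≤ 4 * M ^ 4 * cf⁻¹ ^ 4 * B * (1 / ((n:ℝ) ^ 3 * h ^ 3))
          + (M * cf⁻¹ ^ 2 * B + 2 * M ^ 3 * cf⁻¹ ^ 4 * B) * (1 / ((n:ℝ) ^ 3 * h ^ 3))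
          + 1 / ((n:ℝ) ^ 3 * h ^ 3) := by
        have : 0 ≤ 1 / ((n:ℝ) ^ 3 * h ^ 3) := by positivity
        refine le_add_of_le_of_nonneg ?_ this
        gcongr
      _ = _ := by ring
  · have hlt : t n i < t n (i + 1) :=
      ht_mono n ⟨by omega, by omega⟩ ⟨by omega, by omega⟩ (Nat.lt_succ_self i)
    rw [abs_of_pos (sub_pos.2 hlt)]
    exact dist_le _ (ht_mem n i (by omega) (by omega)) _
      (ht_mem n (i + 1) (by omega) (by omega)) hlt.le (Fstep i h1 h2).le
  · have hm' := hmem m le_rfl hmk.le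
    rw [abs_of_nonneg (sub_nonneg.2 hm'.1)]
    refine dist_le _ ma _ (hsub hm') hm'.1 ?_
    rw [Ft m hm (by omega)]
    rcases hleft with rfl | ⟨h2, hlt⟩
    · have := Fmono 0 z0 _ ma ma.1
      push_cast
      linarith
    · have := Fmono _ (ht_mem n (m - 1) (by omega) (by omega)) _ ma hlt.le
      rw [Ft (m - 1) (by omega) (by omega), Nat.cast_sub hm, Nat.cast_one, sub_div] at this
      linarith
  · have hk' := hmem k hmk.le le_rfl
    rw [abs_sub_comm, abs_of_nonneg (sub_nonneg.2 hk'.2)]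
    refine dist_le _ (hsub hk') _ mb hk'.2 ?_
    rw [Ft k (by omega) hkn]
    rcases hright with rfl | ⟨h2, hlt⟩
    · have := Fmono _ mb 1 z1 mb.2
      rw [div_self n0.ne']
      have : 0 ≤ 1 / (k:ℝ) := by positivity
      linarith
    · have := Fmono _ mb _ (ht_mem n (k + 1) (by omega) (by omega)) hlt.le
      rw [Ft (k + 1) (by omega) (by omega), Nat.cast_add, Nat.cast_one, add_div] at this
      linarith
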